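/- Fix integers N ≥ 1 and n ≥ 1 and ε ∈ (0, 1/2]. Let (λ_i)_{i≥1} be a nondecreasing sequence of positive reals, q_c ∈ ℝ, and (a_i), (b_i), (c_i) real sequences with S_a := ∑_{i>N} a_i² < ∞, S_b := ∑_{i>N} b_i² < ∞ and M₂ := ∑_{i>N} c_i²/λ_i^{3/2+ε} < ∞. Let A be a real n×n matrix, B ∈ ℝⁿ a column vector, C ∈ ℝ^{1×n} a row vector, μ ∈ ℝ, and set A_e = A + μBC. Define A_N = diag(−λ₁+q_c, …, −λ_N+q_c), B_{a,N} = (a₁,…,a_N)ᵀ, B_{b,N} = (b₁,…,b_N)ᵀ, C_N = (c₁,…,c_N), F = [[A_N + B_{b,N}CBC_N, B_{a,N}C + B_{b,N}CA_e], [BC_N, A_e]], G = [B_{b,N}CB; B], and H = blockdiag( S_b · C_NᵀBᵀCᵀCBC_N , S_a · CᵀC + S_b · A_eᵀCᵀCA_e ). Assume there exist a symmetric positive definite (N+n)×(N+n) matrix P, α > 2, β > 0 and η > 0 such that the symmetric matrices Θ_{1,η} = [[FᵀP + PF + 2ηP + αH, PG], [GᵀP, α S_b (CB)² − β]] and Θ_{2,η}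 = [[−λ_{N+1} + q_c + η + (βM₂/2)λ_{N+1}^{1/2+ε}, √(2λ_{N+1})], [√(2λ_{N+1}), −α]] are negative semidefinite, and the symmetric matrix Θ₃ = [[1 − βM₂/(2λ_{N+1}^{1/2−ε}), √2], [√2, α]] is positive definite. Let x : [0,∞) → ℝⁿ and w_i : [0,∞) → ℝ (i ≥ 1) be continuous functions, differentiable on (0,∞), such that for every t ≥ 0 the series ∑_{j≥1} c_j w_j(t) converges absolutely, ∑_{i>N} λ_i^{3/2+ε} w_i(t)² < ∞, ∑_{i>N} λ_i w_i(t)² < ∞ and ∑_{i>N} λ_i² w_i(t)² < ∞, satisfying for all t > 0 and all i ≥ 1: w_i'(t) = (−λ_i + q_c) w_i(t) + a_i C x(t) + b_i C ( A_e x(t) + B ∑_{j≥1} c_j w_j(t) ) and x'(t) = A_e x(t) + B ∑_{j≥1} c_j w_j(t). Assume further that S(t) = ∑_{i>N} λ_i w_i(t)² is continuous on [0,∞) and differentiable on (0,∞) with S'(t) = ∑_{i>N} 2 λ_i w_i(t) w_i'(t), the series converging absolutely. Then, with X(t) = (w₁(t),…,w_N(t), x(t)ᵀ)ᵀ ∈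 ℝ^{N+n} and V(t) = X(t)ᵀ P X(t) + S(t), one has V(t) ≤ e^{−2ηt} V(0) for all t ≥ 0. -/

import Mathlib

open Real Set Matrix

lemma hasDerivAt_dotProduct_mulVec_self {m : Type*} [Fintype m] (P : Matrix m m ℝ)
    {X : ℝ → m → ℝ} {X' : m → ℝ} {t : ℝ} (h : ∀ i, HasDerivAt (fun s => X s i) (X' i) t) :
    HasDerivAt (fun s => X s ⬝ᵥ P *ᵥ X s) (X' ⬝ᵥ P *ᵥ X t + X t ⬝ᵥ P *ᵥ X') t := by
  have hP : ∀ i, HasDerivAt (fun s => (P *ᵥ X s) i) ((P *ᵥ X') i) t := fun i =>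
    HasDerivAt.fun_sum fun j _ => (h j).const_mul (P i j)
  have := HasDerivAt.fun_sum (u := Finset.univ) fun i _ => (h i).mul (hP i)
  rw [Finset.sum_add_distrib] at this
  exact this

lemma continuousOn_dotProduct_mulVec_self {m : Type*} [Fintype m] (P : Matrix m m ℝ)
    {X : ℝ → m → ℝ} {s : Set ℝ} (h : ∀ i, ContinuousOn (fun t => X t i) s) :
    ContinuousOn (fun t => X t ⬝ᵥ P *ᵥ X t) s :=
  continuousOn_finsetSum _ fun i _ => (h i).mul <|
    continuousOn_finsetSum _ fun j _ => continuousOn_const.mul (h j)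

lemma mulVec_fin_one_apply {m : Type*} (M : Matrix m (Fin 1) ℝ) (v : Fin 1 → ℝ) (i : m) :
    (M *ᵥ v) i = M i 0 * v 0 := by
  simp [Matrix.mulVec, dotProduct]

lemma dotProduct_transpose_mul_self_mulVec {m : Type*} [Fintype m] (M : Matrix (Fin 1) m ℝ)
    (v : m → ℝ) : v ⬝ᵥ (Mᵀ * M) *ᵥ v = ((M *ᵥ v) 0) ^ 2 := by
  rw [← Matrix.mulVec_mulVec, Matrix.dotProduct_mulVec, Matrix.vecMul_transpose]
  simp [dotProduct, sq]

/-- Cauchy–Schwarz for convergent series. -/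
lemma HasSum.sq_le_mul {ι : Type*} {r f g : ι → ℝ} {x y z : ℝ} (hr : HasSum r x)
    (hf : HasSum f y) (hg : HasSum g z) (hf0 : ∀ i, 0 ≤ f i) (hg0 : ∀ i, 0 ≤ g i)
    (h : ∀ i, r i ^ 2 ≤ f i * g i) : x ^ 2 ≤ y * z :=
  le_of_tendsto_of_tendsto' (Filter.Tendsto.pow hr 2) (Filter.Tendsto.mul hf hg) fun s =>
    Finset.sum_sq_le_sum_mul_sum_of_sq_le_mul s (fun i _ => hf0 i) (fun i _ => hg0 i)
      fun i _ => h i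

lemma two_mul_mul_le_sq_div_add {α : ℝ} (hα : 0 < α) (p q : ℝ) :
    2 * p * q ≤ p ^ 2 / α + α * q ^ 2 := by
  have h : p ^ 2 / α + α * q ^ 2 - 2 * p * q = (p - α * q) ^ 2 / α := by
    field_simp
    ring
  have : 0 ≤ (p - α * q) ^ 2 / α := by positivity
  linarith

/-- If `-δ y + r + K y ^ p` is nonpositive at `y = L` and `K L ^ (p - 1) ≤ δ`, then it is
nonpositive for all `y ≥ L`. -/
lemma rate_nonpos_of_le {L l K r δ p : ℝ} (hL : 0 < L) (hl : L ≤ l) (hK : 0 ≤ K) (hp : p ≤ 1)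
    (h₀ : -δ * L + r + K * L ^ p ≤ 0) (h₁ : K * L ^ (p - 1) ≤ δ) :
    -δ * l + r + K * l ^ p ≤ 0 := by
  have hl0 : 0 < l := hL.trans_le hl
  have e : ∀ y : ℝ, 0 < y → y ^ p = y * y ^ (p - 1) := fun y hy => by
    rw [Real.rpow_sub_one hy.ne']
    field_simp
  have hmono : l ^ (p - 1) ≤ L ^ (p - 1) :=
    Real.rpow_le_rpow_of_nonpos hL hl (by linarith)
  rw [e L hL] at h₀
  rw [e l hl0]
  have h₂ : K * (l * l ^ (p - 1)) ≤ K * (l * L ^ (p - 1)) := by gcongr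
  nlinarith [mul_nonneg (sub_nonneg.2 hl) (sub_nonneg.2 h₁)]

/-- Grönwall-type decay from a differential inequality. -/
lemma le_exp_neg_mul_of_hasDerivAt_le {V : ℝ → ℝ} {k : ℝ} (hc : ContinuousOn V (Ici 0))
    (hd : ∀ t, 0 < t → ∃ v, HasDerivAt V v t ∧ v + k * V t ≤ 0) {t : ℝ} (ht : 0 ≤ t) :
    V t ≤ Real.exp (-k * t) * V 0 := by
  have hd' : ∀ s v, HasDerivAt V v s → HasDerivAt (fun s => Real.exp (k * s) * V s)
      (Real.exp (k * s) * (v + k * V s)) s := fun s v hv => by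
    have h := (((hasDerivAt_id s).const_mul k).exp).mul hv
    exact h.congr_deriv (by simp only [id]; ring)
  have hanti : AntitoneOn (fun s => Real.exp (k * s) * V s) (Ici 0) := by
    refine antitoneOn_of_deriv_nonpos (convex_Ici 0) ?_ ?_ ?_
    · exact (by fun_prop : Continuous fun s => Real.exp (k * s)).continuousOn.mul hc
    · rw [interior_Ici]
      intro s hs
      obtain ⟨v, hv, -⟩ := hd s hs
      exact (hd' s v hv).differentiableAt.differentiableWithinAt
    · rw [interior_Ici]
      intro s hs
      obtain ⟨v, hv, hle⟩ := hd s hs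
      rw [(hd' s v hv).deriv]
      exact mul_nonpos_of_nonneg_of_nonpos (Real.exp_pos _).le hle
  have h := hanti (mem_Ici.2 le_rfl) (mem_Ici.2 ht) ht
  simp only [mul_zero, Real.exp_zero, one_mul] at h
  calc V t = Real.exp (-k * t) * (Real.exp (k * t) * V t) := by
        rw [← mul_assoc, ← Real.exp_add]; simp
    _ ≤ _ := by gcongr

/-- Termwise Young inequalities for the tail modes, with the measurement coupling absorbed by the
rate condition. -/
lemma tail_term_le {α l w a b q η K ρ z u₁ u₂ u₃ : ℝ} (hα : 0 < α) (hl : 0 < l)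
    (hrate : -(1 - 2 / α) * l + (q + η) + K * ρ ≤ 0) :
    2 * l * w * ((-l + q) * w + a * z + b * (u₁ + u₂ + u₃))
      ≤ α * z ^ 2 * a ^ 2 + α * (u₁ ^ 2 + u₂ ^ 2 + u₃ ^ 2) * b ^ 2
        + -(2 * η) * (l * w ^ 2) + -(2 * K) * (l * ρ * w ^ 2) := by
  have h₀ := mul_nonpos_of_nonneg_of_nonpos (by positivity : 0 ≤ 2 * l * w ^ 2) hrate
  have ha := two_mul_mul_le_sq_div_add hα (l * w) (a * z)
  have h₁ := two_mul_mul_le_sq_div_add hα (l * w) (b * u₁)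
  have h₂ := two_mul_mul_le_sq_div_add hα (l * w) (b * u₂)
  have h₃ := two_mul_mul_le_sq_div_add hα (l * w) (b * u₃)
  have e : 2 * l * w ^ 2 * (2 / α * l) = 4 * ((l * w) ^ 2 / α) := by ring
  nlinarith

/-- The scalar inequality carried by a negative semidefinite `2 × 2` block. -/
lemma schur_nonpos_of_neg_posSemidef {s d α : ℝ} (hα : 0 < α)
    (h : (-!![s, d; d, -α] : Matrix (Fin 2) (Fin 2) ℝ).PosSemidef) : s + d ^ 2 / α ≤ 0 := by
  have h := h.dotProduct_mulVec_nonneg ![1, d / α]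
  simp [Matrix.mulVec, dotProduct, Fin.sum_univ_two] at h
  have e : -s + -(d * (d / α)) + d / α * (-d + α * (d / α)) = -(s + d ^ 2 / α) := by
    field_simp
    ring
  linarith

lemma schur_pos_of_posDef {s d α : ℝ} (hα : 0 < α)
    (h : (!![s, d; d, α] : Matrix (Fin 2) (Fin 2) ℝ).PosDef) : 0 < s - d ^ 2 / α := by
  have h := h.dotProduct_mulVec_pos (x := ![1, -(d / α)]) (fun h => by simpa using congrFun h 0)
  simp [Matrix.mulVec, dotProduct, Fin.sum_univ_two] at h
  have e : s + -(d * (d / α)) + -(d / α * (d + -(α * (d / α)))) = s - d ^ 2 / α := by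
    field_simp
    ring
  linarith

/-- The inequality carried by the bordered negative semidefinite matrix. -/
lemma bordered_quadForm_nonpos {m : Type*} [Fintype m] {F P Q : Matrix m m ℝ}
    {G : Matrix m (Fin 1) ℝ} {g : ℝ}
    (h : (-Matrix.fromBlocks (Fᵀ * P + P * F + Q) (P * G) (Gᵀ * P)
      (Matrix.of fun (_ : Fin 1) (_ : Fin 1) => g)).PosSemidef) (X : m → ℝ) (ζ : ℝ) :
    (F *ᵥ X + G *ᵥ (fun _ => ζ)) ⬝ᵥ P *ᵥ X + X ⬝ᵥ P *ᵥ (F *ᵥ X + G *ᵥ (fun _ => ζ))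
      + X ⬝ᵥ Q *ᵥ X + g * ζ ^ 2 ≤ 0 := by
  have h := h.dotProduct_mulVec_nonneg (Sum.elim X fun _ => ζ)
  have e : (Sum.elim X fun _ => ζ) ⬝ᵥ (Matrix.fromBlocks (Fᵀ * P + P * F + Q) (P * G) (Gᵀ * P)
      (Matrix.of fun (_ : Fin 1) (_ : Fin 1) => g)) *ᵥ (Sum.elim X fun _ => ζ) =
    (F *ᵥ X + G *ᵥ (fun _ => ζ)) ⬝ᵥ P *ᵥ X + X ⬝ᵥ P *ᵥ (F *ᵥ X + G *ᵥ (fun _ => ζ))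
      + X ⬝ᵥ Q *ᵥ X + g * ζ ^ 2 := by
    have t₁ : X ⬝ᵥ (Fᵀ * P) *ᵥ X = (F *ᵥ X) ⬝ᵥ P *ᵥ X := by
      rw [← Matrix.mulVec_mulVec, Matrix.dotProduct_mulVec, Matrix.vecMul_transpose]
    have t₂ : (fun _ : Fin 1 => ζ) ⬝ᵥ (Gᵀ * P) *ᵥ X = (G *ᵥ fun _ => ζ) ⬝ᵥ P *ᵥ X := by
      rw [← Matrix.mulVec_mulVec, Matrix.dotProduct_mulVec, Matrix.vecMul_transpose]
    have t₃ : (fun _ : Fin 1 => ζ) ⬝ᵥ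
        (Matrix.of fun (_ : Fin 1) (_ : Fin 1) => g) *ᵥ (fun _ => ζ) = g * ζ ^ 2 := by
      simp [Matrix.mulVec, dotProduct]
      ring
    simp only [Matrix.fromBlocks_mulVec, sumElim_dotProduct_sumElim, Matrix.add_mulVec,
      Matrix.mulVec_add, add_dotProduct, dotProduct_add, Sum.elim_comp_inl, Sum.elim_comp_inr,
      t₁, t₂, t₃, Matrix.mulVec_mulVec]
    ring
  rw [star_trivial, Matrix.neg_mulVec, dotProduct_neg, e] at h
  linarith

/-- Core Lyapunov decay estimate of Theorem 2 at the level of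
the spectrally reduced system: under the LMI conditions `Θ_{1,η} ⪯ 0`,
`Θ_{2,η} ⪯ 0` and `Θ₃ ≻ 0` (Neumann measurement, constant `M₂ = M_{2,φ}(ε)`),
the Lyapunov functional `V(t) = X(t)ᵀPX(t) + ∑_{i>N} λ_i w_i(t)²` along the
trajectories of the reduced dynamics satisfies `V(t) ≤ e^{−2ηt} V(0)` for all
`t ≥ 0`. -/
theorem lyapunov_decay_neumann_measurement
    (N n : ℕ) (hN : 1 ≤ N) (hn : 1 ≤ n) (ε : ℝ) (hε : ε ∈ Set.Ioc (0:ℝ) (1/2))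
    (lam : ℕ → ℝ)
    (hlampos : ∀ i : ℕ, 1 ≤ i → 0 < lam i)
    (hlammono : ∀ i j : ℕ, 1 ≤ i → i ≤ j → lam i ≤ lam j)
    (qc : ℝ) (a b c : ℕ → ℝ) (Sa Sb M₂ : ℝ)
    (hSa : HasSum (fun k : ℕ => (a (k + N + 1)) ^ 2) Sa)
    (hSb : HasSum (fun k : ℕ => (b (k + N + 1)) ^ 2) Sb)
    (hM₂ : HasSum (fun k : ℕ =>
      (c (k + N + 1)) ^ 2 / lam (k + N + 1) ^ ((3:ℝ)/2 + ε)) M₂)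
    (A : Matrix (Fin n) (Fin n) ℝ) (B : Matrix (Fin n) (Fin 1) ℝ)
    (C : Matrix (Fin 1) (Fin n) ℝ) (μ : ℝ)
    (Ae : Matrix (Fin n) (Fin n) ℝ) (hAe : Ae = A + μ • (B * C))
    (AN : Matrix (Fin N) (Fin N) ℝ)
    (hAN : AN = Matrix.diagonal (fun i : Fin N => -lam ((i : ℕ) + 1) + qc))
    (BaN : Matrix (Fin N) (Fin 1) ℝ)
    (hBaN : BaN = Matrix.of fun (i : Fin N) (_ : Fin 1) => a ((i : ℕ) + 1))
    (BbN : Matrix (Fin N) (Fin 1) ℝ)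
    (hBbN : BbN = Matrix.of fun (i : Fin N) (_ : Fin 1) => b ((i : ℕ) + 1))
    (CN : Matrix (Fin 1) (Fin N) ℝ)
    (hCN : CN = Matrix.of fun (_ : Fin 1) (j : Fin N) => c ((j : ℕ) + 1))
    (F : Matrix (Fin N ⊕ Fin n) (Fin N ⊕ Fin n) ℝ)
    (hF : F = Matrix.fromBlocks (AN + BbN * C * B * CN) (BaN * C + BbN * C * Ae)
      (B * CN) Ae)
    (G : Matrix (Fin N ⊕ Fin n) (Fin 1) ℝ)
    (hG : G = Matrix.of fun (i : Fin N ⊕ Fin n) (j : Fin 1) =>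
      Sum.elim (fun k => (BbN * C * B) k j) (fun k => B k j) i)
    (H : Matrix (Fin N ⊕ Fin n) (Fin N ⊕ Fin n) ℝ)
    (hH : H = Matrix.fromBlocks (Sb • (CNᵀ * Bᵀ * Cᵀ * C * B * CN)) 0 0
      (Sa • (Cᵀ * C) + Sb • (Aeᵀ * Cᵀ * C * Ae)))
    (P : Matrix (Fin N ⊕ Fin n) (Fin N ⊕ Fin n) ℝ)
    (hPsymm : P.IsSymm) (hPpos : P.PosDef)
    (α β η : ℝ) (hα : 2 < α) (hβ : 0 < β) (hη : 0 < η)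
    (Θ₁ : Matrix ((Fin N ⊕ Fin n) ⊕ Fin 1) ((Fin N ⊕ Fin n) ⊕ Fin 1) ℝ)
    (hΘ₁def : Θ₁ = Matrix.fromBlocks
      (Fᵀ * P + P * F + (2 * η) • P + α • H) (P * G) (Gᵀ * P)
      (Matrix.of fun (_ : Fin 1) (_ : Fin 1) =>
        α * Sb * ((C * B) 0 0) ^ 2 - β))
    (hΘ₁ : (-Θ₁).PosSemidef)
    (Θ₂ : Matrix (Fin 2) (Fin 2) ℝ)
    (hΘ₂def : Θ₂ = !![-lam (N + 1) + qc + η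
        + β * M₂ / 2 * lam (N + 1) ^ ((1:ℝ)/2 + ε),
        Real.sqrt (2 * lam (N + 1));
      Real.sqrt (2 * lam (N + 1)), -α])
    (hΘ₂ : (-Θ₂).PosSemidef)
    (Θ₃ : Matrix (Fin 2) (Fin 2) ℝ)
    (hΘ₃def : Θ₃ = !![1 - β * M₂ / (2 * lam (N + 1) ^ ((1:ℝ)/2 - ε)),
        Real.sqrt 2; Real.sqrt 2, α])
    (hΘ₃ : Θ₃.PosDef)
    (x : ℝ → Fin n → ℝ) (w : ℕ → ℝ → ℝ)
    (hxcont : ∀ i : Fin n, ContinuousOn (fun t => x t i) (Ici (0:ℝ)))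
    (hwcont : ∀ i : ℕ, 1 ≤ i → ContinuousOn (w i) (Ici (0:ℝ)))
    (hRabs : ∀ t : ℝ, 0 ≤ t → Summable (fun j : ℕ => |c (j + 1) * w (j + 1) t|))
    (hsum0 : ∀ t : ℝ, 0 ≤ t → Summable (fun k : ℕ =>
      lam (k + N + 1) ^ ((3:ℝ)/2 + ε) * (w (k + N + 1) t) ^ 2))
    (hsum1 : ∀ t : ℝ, 0 ≤ t →
      Summable (fun k : ℕ => lam (k + N + 1) * (w (k + N + 1) t) ^ 2))
    (hsum2 : ∀ t : ℝ, 0 ≤ t →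
      Summable (fun k : ℕ => (lam (k + N + 1)) ^ 2 * (w (k + N + 1) t) ^ 2))
    (R : ℝ → ℝ) (hR : ∀ t : ℝ, R t = ∑' j : ℕ, c (j + 1) * w (j + 1) t)
    (u : ℝ → Fin n → ℝ)
    (hu : ∀ t : ℝ, u t = Ae.mulVec (x t) + R t • (fun k : Fin n => B k 0))
    (hw : ∀ t : ℝ, 0 < t → ∀ i : ℕ, 1 ≤ i →
      HasDerivAt (w i) ((-lam i + qc) * w i t + a i * (C.mulVec (x t) 0)
        + b i * (C.mulVec (u t) 0)) t)
    (hx : ∀ t : ℝ, 0 < t → ∀ i : Fin n, HasDerivAt (fun s => x s i) (u t i) t)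
    (S : ℝ → ℝ)
    (hS : ∀ t : ℝ, 0 ≤ t →
      HasSum (fun k : ℕ => lam (k + N + 1) * (w (k + N + 1) t) ^ 2) (S t))
    (hScont : ContinuousOn S (Ici (0:ℝ)))
    (hSabs : ∀ t : ℝ, 0 < t → Summable (fun k : ℕ =>
      |2 * lam (k + N + 1) * w (k + N + 1) t *
        ((-lam (k + N + 1) + qc) * w (k + N + 1) t
          + a (k + N + 1) * (C.mulVec (x t) 0)
          + b (k + N + 1) * (C.mulVec (u t) 0))|))
    (hSderiv : ∀ t : ℝ, 0 < t → HasDerivAt S (∑' k : ℕ,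
      2 * lam (k + N + 1) * w (k + N + 1) t *
        ((-lam (k + N + 1) + qc) * w (k + N + 1) t
          + a (k + N + 1) * (C.mulVec (x t) 0)
          + b (k + N + 1) * (C.mulVec (u t) 0))) t)
    (X : ℝ → (Fin N ⊕ Fin n) → ℝ)
    (hX : ∀ t : ℝ, X t = Sum.elim (fun i : Fin N => w ((i : ℕ) + 1) t) (x t))
    (V : ℝ → ℝ)
    (hV : ∀ t : ℝ, V t = X t ⬝ᵥ P.mulVec (X t) + S t) :
    ∀ t : ℝ, 0 ≤ t → V t ≤ Real.exp (-2 * η * t) * V 0 := by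
  have hα0 : 0 < α := by linarith
  have hl : ∀ k : ℕ, 0 < lam (k + N + 1) := fun k => hlampos _ (by omega)
  have hM₂0 : 0 ≤ M₂ := hM₂.nonneg fun k => div_nonneg (sq_nonneg _) (Real.rpow_nonneg (hl k).le _)
  have hL : 0 < lam (N + 1) := hlampos _ (by omega)
  have hrate : ∀ k : ℕ, -(1 - 2 / α) * lam (k + N + 1) + (qc + η)
      + β * M₂ / 2 * lam (k + N + 1) ^ ((1:ℝ)/2 + ε) ≤ 0 := by
    intro k
    rw [hΘ₂def] at hΘ₂
    rw [hΘ₃def] at hΘ₃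
    have h₂ := schur_nonpos_of_neg_posSemidef hα0 hΘ₂
    have h₃ := schur_pos_of_posDef hα0 hΘ₃
    rw [Real.sq_sqrt (by positivity)] at h₂ h₃
    refine rate_nonpos_of_le hL (hlammono _ _ (by omega) (by omega)) (by positivity)
      (by linarith [hε.2]) ?_ ?_
    · have : 2 * lam (N + 1) / α = 2 / α * lam (N + 1) := by ring
      linarith
    · have e : β * M₂ / 2 * lam (N + 1) ^ ((1:ℝ)/2 + ε - 1)
          = β * M₂ / (2 * lam (N + 1) ^ ((1:ℝ)/2 - ε)) := by
        rw [show (1:ℝ)/2 + ε - 1 = -((1:ℝ)/2 - ε) by ring, Real.rpow_neg hL.le]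
        field_simp
      linarith
  have hXcont : ∀ i, ContinuousOn (fun t => X t i) (Ici 0) := by
    rintro (i | i)
    · simpa only [hX, Sum.elim_inl] using hwcont (i + 1) (by omega)
    · simpa only [hX, Sum.elim_inr] using hxcont i
  have hVeq : V = (fun t => X t ⬝ᵥ P *ᵥ X t) + S := funext hV
  let ζ : ℝ → ℝ := fun t => ∑' k : ℕ, c (k + N + 1) * w (k + N + 1) t
  let X' : ℝ → (Fin N ⊕ Fin n) → ℝ := fun t => F *ᵥ X t + G *ᵥ (fun _ => ζ t)
  let W : ℝ → Fin N → ℝ := fun t i => w (i + 1) t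
  have hζ : ∀ t, 0 ≤ t → HasSum (fun k : ℕ => c (k + N + 1) * w (k + N + 1) t) (ζ t) :=
    fun t ht => ((summable_nat_add_iff N).2 (hRabs t ht).of_abs).hasSum
  have hRsplit : ∀ t, 0 ≤ t → R t = (CN *ᵥ W t) 0 + ζ t := by
    intro t ht
    rw [hR, ← (hRabs t ht).of_abs.sum_add_tsum_nat_add N, hCN,
      ← Fin.sum_univ_eq_sum_range (fun j => c (j + 1) * w (j + 1) t)]
    rfl
  have hCu : ∀ t, 0 ≤ t → (C *ᵥ u t) 0 =
      ((C * Ae) *ᵥ x t) 0 + ((C * B * CN) *ᵥ W t) 0 + (C * B) 0 0 * ζ t := by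
    intro t ht
    have : (fun k => B k 0) = B *ᵥ fun _ => (1:ℝ) := by
      ext i
      simp [mulVec_fin_one_apply]
    rw [hu, hRsplit t ht, this, Matrix.mulVec_add, Matrix.mulVec_smul, Matrix.mulVec_mulVec,
      Matrix.mulVec_mulVec, ← Matrix.mulVec_mulVec _ (C * B) CN]
    simp only [Pi.add_apply, Pi.smul_apply, mulVec_fin_one_apply, smul_eq_mul]
    ring
  have hX' : ∀ t, 0 < t → ∀ i, HasDerivAt (fun s => X s i) (X' t i) t := by
    rintro t ht (i | i)
    · simp only [hX, Sum.elim_inl]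
      refine (hw t ht (i + 1) (by omega)).congr_deriv ?_
      rw [hCu t ht.le]
      simp only [X', hX, hF, hG, hAN, Matrix.fromBlocks_mulVec, Pi.add_apply, Sum.elim_inl,
        Sum.elim_comp_inl, Sum.elim_comp_inr, Matrix.add_mulVec, Matrix.mul_assoc,
        Matrix.mulVec_diagonal, mulVec_fin_one_apply, Matrix.of_apply]
      simp only [← Matrix.mulVec_mulVec _ BbN, ← Matrix.mulVec_mulVec _ BaN, mulVec_fin_one_apply]
      have e : (BbN * (C * B)) i 0 = BbN i 0 * (C * B) 0 0 := by
        simp [Matrix.mul_apply (M := BbN)]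
      rw [e]
      simp only [hBaN, hBbN, Matrix.of_apply, W]
      ring
    · simp only [hX, Sum.elim_inr]
      refine (hx t ht i).congr_deriv ?_
      rw [hu, hRsplit t ht.le]
      simp only [X', hX, hF, hG, Matrix.fromBlocks_mulVec, Pi.add_apply, Sum.elim_inr,
        Sum.elim_comp_inl, Sum.elim_comp_inr, mulVec_fin_one_apply, Matrix.of_apply,
        ← Matrix.mulVec_mulVec _ B, Pi.smul_apply, smul_eq_mul, W]
      ring
  have hXH : ∀ t, X t ⬝ᵥ H *ᵥ X t = Sb * (((C * B * CN) *ᵥ W t) 0) ^ 2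
      + (Sa * ((C *ᵥ x t) 0) ^ 2 + Sb * (((C * Ae) *ᵥ x t) 0) ^ 2) := by
    intro t
    have e₁ : CNᵀ * Bᵀ * Cᵀ * C * B * CN = (C * B * CN)ᵀ * (C * B * CN) := by
      simp only [Matrix.transpose_mul, Matrix.mul_assoc]
    have e₂ : Aeᵀ * Cᵀ * C * Ae = (C * Ae)ᵀ * (C * Ae) := by
      simp only [Matrix.transpose_mul, Matrix.mul_assoc]
    rw [hX, hH, e₁, e₂]
    simp only [Matrix.fromBlocks_mulVec, sumElim_dotProduct_sumElim, Sum.elim_comp_inl,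
      Sum.elim_comp_inr, Matrix.zero_mulVec, add_zero, zero_add, Matrix.add_mulVec,
      Matrix.smul_mulVec, dotProduct_add, dotProduct_smul, dotProduct_transpose_mul_self_mulVec,
      smul_eq_mul, W]
  intro t ht
  rw [neg_mul]
  refine le_exp_neg_mul_of_hasDerivAt_le (k := 2 * η) ?_ (fun s hs => ?_) ht
  · rw [hVeq]
    exact (continuousOn_dotProduct_mulVec_self P hXcont).add hScont
  have hVderiv := (hasDerivAt_dotProduct_mulVec_self P (hX' s hs)).add (hSderiv s hs)
  rw [← hVeq] at hVderiv
  refine ⟨_, hVderiv, ?_⟩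
  have hpow : ∀ k : ℕ, lam (k + N + 1) ^ ((3:ℝ)/2 + ε)
      = lam (k + N + 1) * lam (k + N + 1) ^ ((1:ℝ)/2 + ε) := fun k => by
    rw [show (3:ℝ)/2 + ε = 1 + ((1:ℝ)/2 + ε) by ring, Real.rpow_add (hl k), Real.rpow_one]
  obtain ⟨T, hT⟩ := hsum0 s hs.le
  have hζT : ζ s ^ 2 ≤ M₂ * T := (hζ s hs.le).sq_le_mul hM₂ hT
    (fun k => div_nonneg (sq_nonneg _) (Real.rpow_nonneg (hl k).le _))
    (fun k => mul_nonneg (Real.rpow_nonneg (hl k).le _) (sq_nonneg _)) fun k => by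
      have := (Real.rpow_pos_of_pos (hl k) ((3:ℝ)/2 + ε)).ne'
      rw [← mul_assoc, div_mul_cancel₀ _ this, mul_pow]
  simp only [hpow] at hT
  have htail := hasSum_le (fun k : ℕ => tail_term_le (w := w (k + N + 1) s) (a := a (k + N + 1))
      (b := b (k + N + 1)) (z := (C *ᵥ x s) 0) (u₁ := ((C * Ae) *ᵥ x s) 0)
      (u₂ := ((C * B * CN) *ᵥ W s) 0) (u₃ := (C * B) 0 0 * ζ s) hα0 (hl k) (hrate k))
    (by simpa only [hCu s hs.le] using (hSabs s hs).of_abs.hasSum)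
    ((((hSa.mul_left _).add (hSb.mul_left _)).add ((hS s hs.le).mul_left _)).add
      (hT.mul_left _))
  rw [hΘ₁def, add_assoc (Fᵀ * P + P * F)] at hΘ₁
  have hquad := bordered_quadForm_nonpos hΘ₁ (X s) (ζ s)
  rw [Matrix.add_mulVec, Matrix.smul_mulVec, Matrix.smul_mulVec, dotProduct_add,
    dotProduct_smul, dotProduct_smul, hXH, smul_eq_mul, smul_eq_mul] at hquad
  have hβζ := mul_le_mul_of_nonneg_left hζT hβ.le
  rw [hV]
  simp only [hCu s hs.le] at htail ⊢
  nlinarith
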